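/- If max{2−β, β} < δ ≤ 2−β+2√(1−β), then the second iterate f² (viewed as a map of E = [0,1/k] to itself) is turbulent if and only if j(δ) ≥ 0, where j(δ) = δ³ + 3βδ² − 2δ² + 3β²δ − 4βδ − 4δ + β³ − 2β² − 4β − 8. -/

import Mathlib

open Set

/-- The nonlinear macrodynamics map `f(Y) = β·Y + δ·Y·(1 − k·Y)`. -/
noncomputable def f (β k δ : ℝ) : ℝ → ℝ := fun Y => β * Y + δ * Y * (1 - k * Y)

/-- The cubic `j(δ) = δ³ + 3βδ² − 2δ² + 3β²δ − 4βδ − 4δ + β³ − 2β² − 4β − 8`. -/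
noncomputable def j (β : ℝ) : ℝ → ℝ := fun δ =>
  δ ^ 3 + 3 * β * δ ^ 2 - 2 * δ ^ 2 + 3 * β ^ 2 * δ - 4 * β * δ - 4 * δ
    + β ^ 3 - 2 * β ^ 2 - 4 * β - 8

/-- A map `g` is turbulent on `E` if there are `x₁, x₂, x₃ ∈ E` with `g x₁ = x₁`,
`g x₂ = x₁`, `g x₃ = x₂` and either `x₁ < x₃ < x₂` or `x₂ < x₃ < x₁`. -/
def Turbulent (g : ℝ → ℝ) (E : Set ℝ) : Prop :=
  ∃ x₁ ∈ E, ∃ x₂ ∈ E, ∃ x₃ ∈ E,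
    g x₁ = x₁ ∧ g x₂ = x₁ ∧ g x₃ = x₂ ∧
    ((x₁ < x₃ ∧ x₃ < x₂) ∨ (x₂ < x₃ ∧ x₃ < x₁))

theorem turbulent_iff_of_semiconj {g h : ℝ → ℝ} {c : ℝ} (hc : 0 < c)
    (hgh : ∀ u, g (c * u) = c * h u) (E : Set ℝ) :
    Turbulent g E ↔ Turbulent h ((fun u => c * u) ⁻¹' E) := by
  have hinv : ∀ x, c * (x / c) = x := fun x => mul_div_cancel₀ x hc.ne'
  have hh : ∀ x, h (x / c) = g x / c := fun x => by
    rw [eq_div_iff hc.ne', mul_comm, ← hgh, hinv]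
  constructor
  · rintro ⟨x₁, h₁, x₂, h₂, x₃, h₃, e₁, e₂, e₃, ho⟩
    refine ⟨x₁ / c, ?_, x₂ / c, ?_, x₃ / c, ?_, ?_, ?_, ?_, ?_⟩
    · simpa only [mem_preimage, hinv] using h₁
    · simpa only [mem_preimage, hinv] using h₂
    · simpa only [mem_preimage, hinv] using h₃
    · rw [hh, e₁]
    · rw [hh, e₂]
    · rw [hh, e₃]
    · simpa only [div_lt_div_iff_of_pos_right hc] using ho
  · rintro ⟨x₁, h₁, x₂, h₂, x₃, h₃, e₁, e₂, e₃, ho⟩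
    refine ⟨c * x₁, h₁, c * x₂, h₂, c * x₃, h₃, ?_, ?_, ?_, ?_⟩
    · rw [hgh, e₁]
    · rw [hgh, e₂]
    · rw [hgh, e₃]
    · simpa only [mul_lt_mul_iff_right₀ hc] using ho

theorem Turbulent.mono {g : ℝ → ℝ} {E E' : Set ℝ} (h : Turbulent g E) (hE : E ⊆ E') :
    Turbulent g E' := by
  obtain ⟨x₁, h₁, x₂, h₂, x₃, h₃, H⟩ := h
  exact ⟨x₁, hE h₁, x₂, hE h₂, x₃, hE h₃, H⟩

/-- The logistic map `x ↦ a·x·(1 − x)`. -/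
def logistic (a x : ℝ) : ℝ := a * x * (1 - x)

theorem logistic_sub (a x y : ℝ) :
    logistic a y - logistic a x = a * ((y - x) * (1 - x - y)) := by
  unfold logistic; ring

theorem continuous_logistic (a : ℝ) : Continuous (logistic a) := by
  unfold logistic; fun_prop

section

variable {a x y : ℝ}

theorem logistic_lt_of_add_lt_one (ha : 0 < a) (hxy : x < y) (h : x + y < 1) :
    logistic a x < logistic a y := by
  have := mul_pos ha (mul_pos (sub_pos.2 hxy) (by linarith : 0 < 1 - x - y))
  linarith [logistic_sub a x y]

theorem logistic_lt_of_one_lt_add (ha : 0 < a) (hxy : x < y) (h : 1 < x + y) :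
    logistic a y < logistic a x := by
  have := mul_pos ha (mul_pos (sub_pos.2 hxy) (by linarith : 0 < x + y - 1))
  linarith [logistic_sub a x y]

/-- Points closer to the midpoint have larger images. -/
theorem logistic_le_of_mem_Icc (ha : 0 < a) (h₁ : 1 - y ≤ x) (h₂ : x ≤ y) :
    logistic a y ≤ logistic a x := by
  have := mul_nonneg ha.le
    (mul_nonneg (sub_nonneg.2 h₂) (by linarith : 0 ≤ x + y - 1))
  linarith [logistic_sub a x y]

theorem logistic_lt_of_mem_Ioo (ha : 0 < a) (h₁ : 1 - y < x) (h₂ : x < y) :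
    logistic a y < logistic a x :=
  logistic_lt_of_one_lt_add ha h₂ (by linarith)

theorem logistic_le (ha : 0 < a) (x : ℝ) : logistic a x ≤ a / 4 := by
  unfold logistic
  nlinarith [mul_nonneg ha.le (sq_nonneg (x - 1 / 2))]

theorem logistic_pos (ha : 0 < a) (h₀ : 0 < x) (h₁ : x < 1) : 0 < logistic a x :=
  mul_pos (mul_pos ha h₀) (by linarith)

theorem eq_or_add_eq_one_of_logistic_eq (ha : 0 < a) (h : logistic a x = logistic a y) :
    x = y ∨ x + y = 1 := by
  have h' := logistic_sub a x y
  rw [h, sub_self] at h'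
  rcases mul_eq_zero.1 (mul_eq_zero.1 h'.symm |>.resolve_left ha.ne') with h | h
  · left; linarith
  · right; linarith

theorem logistic_one_div (ha : 0 < a) : logistic a (1 / a) = 1 - 1 / a := by
  unfold logistic; field_simp

theorem logistic_one_sub (a x : ℝ) : logistic a (1 - x) = logistic a x := by
  unfold logistic; ring

theorem lt_logistic (ha : 2 < a) (h₀ : 0 < x) (h₁ : x < 1 / a) : x < logistic a x := by
  have : x * a < 1 := (lt_div_iff₀ (by linarith)).1 h₁
  unfold logistic
  nlinarith [mul_pos h₀ (by linarith : 0 < a - 1 - x * a)]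

theorem one_sub_div_four_lt (ha : 2 < a) : 1 - a / 4 < 1 / a := by
  rw [lt_div_iff₀ (by linarith)]
  nlinarith

theorem one_div_lt_half (ha : 2 < a) : 1 / a < 1 / 2 :=
  one_div_lt_one_div_of_lt two_pos ha

theorem logistic_logistic_sub (a x : ℝ) :
    logistic a (logistic a x) - x =
      x * (a - 1 - a * x) * (a ^ 2 * x ^ 2 - (a ^ 2 + a) * x + a + 1) := by
  unfold logistic; ring

theorem logistic_logistic_half (a : ℝ) :
    logistic a (logistic a (1 / 2)) = logistic a (a / 4) := by
  unfold logistic; ring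

theorem one_div_lt_logistic_iff (ha : 2 < a) :
    1 / a < logistic a (a / 4) ↔ a ^ 3 - 2 * a ^ 2 - 4 * a - 8 < 0 := by
  rw [div_lt_iff₀ (by linarith)]
  have : (a - 2) * (a ^ 3 - 2 * a ^ 2 - 4 * a - 8) = 16 * (1 - logistic a (a / 4) * a) := by
    unfold logistic; ring
  rw [← mul_lt_mul_iff_right₀ (a := a - 2) (c := 0) (sub_pos.2 ha), mul_zero, this]
  constructor <;> intro h <;> linarith

/-- If the second iterate of the midpoint exceeds `1 / a`, then any point of `[0, a / 4]` sent
below `1 / a` by the second iterate is on the left monotone branch, together with its image. -/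
theorem lt_of_logistic_logistic_lt (ha : 2 < a) (hm : 1 / a < logistic a (a / 4))
    (hx : x ≤ a / 4) (h : logistic a (logistic a x) < 1 / a) :
    logistic a x < 1 - a / 4 ∧ x < 1 - a / 4 := by
  have ha0 : 0 < a := by linarith
  have key : ∀ t, t ≤ a / 4 → logistic a t < 1 / a → t < 1 - a / 4 := fun t ht h => by
    by_contra! hc
    linarith [logistic_le_of_mem_Icc ha0 hc ht]
  have h₁ := key _ (logistic_le ha0 x) h
  exact ⟨h₁, key x hx (h₁.trans (one_sub_div_four_lt ha))⟩

theorem one_sub_one_div_le_logistic (ha : 0 < a) (h₁ : 1 / a ≤ x) (h₂ : x ≤ 1 - 1 / a) :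
    1 - 1 / a ≤ logistic a x := by
  rw [← logistic_one_div ha, ← logistic_one_sub]
  exact logistic_le_of_mem_Icc ha (by linarith) h₂

theorem not_fixed_logistic_logistic (ha : 2 < a) (h₁ : 1 / 2 < x) (h₂ : x < 1 - 1 / a)
    (hm : logistic a (a / 4) < 1 / 2) : logistic a (logistic a x) ≠ x := by
  intro h
  have ha0 : 0 < a := by linarith
  have hax : 0 < a - 1 - a * x := by
    have := mul_lt_mul_of_pos_left h₂ ha0
    rw [mul_sub, mul_one_div_cancel ha0.ne'] at this
    linarith
  have hq : a ^ 2 * x ^ 2 - (a ^ 2 + a) * x + a + 1 = 0 := by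
    have := logistic_logistic_sub a x
    rw [h, sub_self] at this
    exact (mul_eq_zero.1 this.symm).resolve_left (mul_pos (by linarith) hax).ne'
  have hhalf : 0 < a ^ 2 - 2 * a - 4 := by
    have := logistic_logistic_sub a (1 / 2)
    rw [logistic_logistic_half] at this
    by_contra! hc
    nlinarith [mul_nonneg (by linarith : 0 ≤ a - 2) (by linarith : 0 ≤ -(a ^ 2 - 2 * a - 4))]
  have ha3 : 3 < a := by nlinarith
  nlinarith [mul_pos (mul_pos ha0 (sub_pos.2 h₁)) hax]

/-- Non-turbulence of the second iterate on `[1 / a, 1 - 1 / a]`. -/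
theorem not_turbulent_Icc_one_div (ha : 2 < a) (hm : 1 / a < logistic a (a / 4)) :
    ¬ Turbulent (logistic a ∘ logistic a) (Icc (1 / a) (1 - 1 / a)) := by
  rintro ⟨x₁, ⟨l₁, u₁⟩, x₂, ⟨l₂, u₂⟩, x₃, -, e₁, e₂, e₃, ho⟩
  simp only [Function.comp_apply] at e₁ e₂ e₃
  have ha0 : 0 < a := by linarith
  have hr := one_div_lt_half ha
  have v₁ := one_sub_one_div_le_logistic ha0 l₁ u₁
  have v₂ := one_sub_one_div_le_logistic ha0 l₂ u₂
  have hF : logistic a x₁ = logistic a x₂ := by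
    rcases eq_or_add_eq_one_of_logistic_eq ha0 (e₁.trans e₂.symm) with h | h
    · exact h
    · linarith
  have hadd : x₁ + x₂ = 1 := by
    rcases eq_or_add_eq_one_of_logistic_eq ha0 hF with h | h
    · rcases ho with ho | ho <;> linarith
    · exact h
  rcases ho with ⟨h₁, h₂⟩ | ⟨h₁, h₂⟩
  · have h := logistic_lt_of_mem_Ioo ha0 (by linarith) h₂
    have := logistic_lt_of_one_lt_add ha0 h (by linarith)
    linarith
  · have h := logistic_lt_of_mem_Ioo ha0 (by linarith) h₂
    have := logistic_le_of_mem_Icc ha0 (by linarith) (logistic_le ha0 x₃)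
    exact not_fixed_logistic_logistic ha (by linarith) (by linarith) (by linarith) e₁

theorem not_turbulent_Icc_one_div_div_four (ha : 2 < a) (hm : 1 / a < logistic a (a / 4)) :
    ¬ Turbulent (logistic a ∘ logistic a) (Icc (1 / a) (a / 4)) := by
  rintro ⟨x₁, ⟨l₁, u₁⟩, x₂, ⟨l₂, u₂⟩, x₃, ⟨l₃, u₃⟩, e₁, e₂, e₃, ho⟩
  have e₁' := e₁
  have e₂' := e₂
  have e₃' := e₃
  simp only [Function.comp_apply] at e₁ e₂ e₃
  have ha0 : 0 < a := by linarith
  have hr := one_div_lt_half ha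
  have hz : logistic a (1 - 1 / a) = 1 - 1 / a := by
    rw [logistic_one_sub, logistic_one_div ha0]
  have hlow : ∀ t, 1 / a ≤ t → t ≤ a / 4 → 1 / a < logistic a t := fun t h₁ h₂ =>
    hm.trans_le (logistic_le_of_mem_Icc ha0 (by linarith [one_sub_div_four_lt ha]) h₂)
  have hup : ∀ t, 1 - 1 / a ≤ t → logistic a t ≤ 1 - 1 / a := fun t h =>
    (logistic_le_of_mem_Icc ha0 (by linarith) h).trans hz.le
  rcases le_or_gt x₁ (1 - 1 / a) with c₁ | c₁
  · rcases le_or_gt x₂ (1 - 1 / a) with c₂ | c₂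
    · refine not_turbulent_Icc_one_div ha hm
        ⟨x₁, ⟨l₁, c₁⟩, x₂, ⟨l₂, c₂⟩, x₃, ⟨l₃, ?_⟩, e₁', e₂', e₃', ho⟩
      rcases ho with ho | ho <;> linarith
    · have h := logistic_lt_of_one_lt_add ha0 c₂ (by linarith)
      have := logistic_lt_of_mem_Ioo ha0 (by linarith [hlow x₂ l₂ u₂]) (h.trans_eq hz)
      linarith
  · rcases lt_or_ge x₂ (1 - 1 / a) with c₂ | c₂
    · linarith [hup _ (one_sub_one_div_le_logistic ha0 l₂ c₂.le)]
    · have c₃ : 1 - 1 / a ≤ x₃ := by rcases ho with ho | ho <;> linarith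
      refine not_turbulent_Icc_one_div ha hm
        ⟨logistic a x₁, ⟨(hlow _ l₁ u₁).le, hup _ c₁.le⟩,
          logistic a x₂, ⟨(hlow _ l₂ u₂).le, hup _ c₂⟩,
          logistic a x₃, ⟨(hlow _ l₃ u₃).le, hup _ c₃⟩,
          congrArg _ e₁, congrArg _ e₂, congrArg _ e₃, ?_⟩
      rcases ho with ⟨h₁, h₂⟩ | ⟨h₁, h₂⟩
      · exact Or.inr ⟨logistic_lt_of_one_lt_add ha0 h₂ (by linarith),
          logistic_lt_of_one_lt_add ha0 h₁ (by linarith)⟩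
      · exact Or.inl ⟨logistic_lt_of_one_lt_add ha0 h₂ (by linarith),
          logistic_lt_of_one_lt_add ha0 h₁ (by linarith)⟩

theorem not_turbulent_logistic (ha : 2 < a) (ha4 : a < 4) (hm : 1 / a < logistic a (a / 4)) :
    ¬ Turbulent (logistic a ∘ logistic a) (Ico 0 1) := by
  rintro ⟨x₁, ⟨l₁, u₁⟩, x₂, ⟨l₂, u₂⟩, x₃, ⟨l₃, u₃⟩, e₁, e₂, e₃, ho⟩
  have e₁' := e₁
  have e₂' := e₂
  have e₃' := e₃
  simp only [Function.comp_apply] at e₁ e₂ e₃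
  have ha0 : 0 < a := by linarith
  have hr := one_div_lt_half ha
  have hs := one_sub_div_four_lt ha
  have v₁ : x₁ ≤ a / 4 := e₁ ▸ logistic_le ha0 _
  have v₂ : x₂ ≤ a / 4 := e₃ ▸ logistic_le ha0 _
  have hpos : 0 < x₁ := by
    rcases l₁.lt_or_eq with h | h
    · exact h
    · have hx₂ : 0 < x₂ := by rcases ho with ho | ho <;> linarith
      have hF := logistic_pos ha0 hx₂ u₂
      exact (logistic_pos ha0 hF (by linarith [logistic_le ha0 x₂])).trans_eq e₂
  have w₁ : 1 / a ≤ x₁ := by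
    by_contra! hc
    have h := (lt_of_logistic_logistic_lt ha hm v₁ (e₁.trans_lt hc)).1
    have h' := lt_logistic ha hpos hc
    linarith [lt_logistic ha (hpos.trans h') (h.trans hs)]
  have w₂ : 1 / a ≤ x₂ := by
    by_contra! hc
    rcases ho with ho | ⟨h₁, h₂⟩
    · linarith
    · obtain ⟨h, h'⟩ := lt_of_logistic_logistic_lt ha hm (h₂.le.trans v₁) (e₃.trans_lt hc)
      have k := logistic_lt_of_add_lt_one ha0 h₁ (by linarith)
      have := logistic_lt_of_add_lt_one ha0 k (by linarith)
      linarith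
  refine not_turbulent_Icc_one_div_div_four ha hm
    ⟨x₁, ⟨w₁, v₁⟩, x₂, ⟨w₂, v₂⟩, x₃, ?_, e₁', e₂', e₃', ho⟩
  rcases ho with ho | ho <;> constructor <;> linarith

theorem turbulent_logistic (ha : 2 < a) (hm : logistic a (a / 4) ≤ 1 / a) :
    Turbulent (logistic a ∘ logistic a) (Icc (1 / a) (1 - 1 / a)) := by
  have ha0 : 0 < a := by linarith
  have hr := one_div_lt_half ha
  have hz : logistic a (1 - 1 / a) = 1 - 1 / a := by
    rw [logistic_one_sub, logistic_one_div ha0]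
  have hzz : (logistic a ∘ logistic a) (1 - 1 / a) = 1 - 1 / a := by
    rw [Function.comp_apply, hz, hz]
  obtain ⟨x, ⟨h₁, h₂⟩, hx⟩ := intermediate_value_Icc (by linarith : 1 / 2 ≤ 1 - 1 / a)
    ((continuous_logistic a).comp (continuous_logistic a)).continuousOn
    (⟨by rwa [Function.comp_apply, logistic_logistic_half], by rw [hzz]; linarith⟩ :
      1 / a ∈ Icc ((logistic a ∘ logistic a) (1 / 2)) ((logistic a ∘ logistic a) (1 - 1 / a)))
  refine ⟨1 - 1 / a, ⟨by linarith, le_rfl⟩, 1 / a, ⟨le_rfl, by linarith⟩, x, ⟨by linarith, h₂⟩,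
    hzz, ?_, hx, Or.inr ⟨by linarith, h₂.lt_of_ne ?_⟩⟩
  · rw [Function.comp_apply, logistic_one_div ha0, hz]
  · rintro rfl
    linarith

end

theorem f_mul_eq_mul_logistic {β k δ : ℝ} (hk : k ≠ 0) (hδ : δ ≠ 0) (u : ℝ) :
    f β k δ ((β + δ) / (δ * k) * u) = (β + δ) / (δ * k) * logistic (β + δ) u := by
  unfold f logistic
  field_simp
  ring

/-- The second iterate `f²` is turbulent on `E = [0, 1/k]` iff `j(δ) ≥ 0`. -/
theorem stmt_2 (β k δ : ℝ) (hβ0 : 0 < β) (hβ1 : β < 1) (hk : 0 < k) (hδ : 0 < δ)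
    (hlow : max (2 - β) β < δ) (hhigh : δ ≤ 2 - β + 2 * Real.sqrt (1 - β)) :
    Turbulent (f β k δ ∘ f β k δ) (Set.Icc 0 (1 / k)) ↔ 0 ≤ j β δ := by
  have ha0 : 0 < β + δ := by linarith
  have ha : 2 < β + δ := by linarith [(max_lt_iff.1 hlow).1]
  have ha4 : β + δ < 4 := by
    have : Real.sqrt (1 - β) < 1 := (Real.sqrt_lt' one_pos).2 (by linarith)
    linarith
  have hc : 0 < (β + δ) / (δ * k) := by positivity
  have hj : j β δ = (β + δ) ^ 3 - 2 * (β + δ) ^ 2 - 4 * (β + δ) - 8 := by unfold j; ring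
  rw [turbulent_iff_of_semiconj (h := logistic (β + δ) ∘ logistic (β + δ)) hc fun u => by
    simp only [Function.comp_apply, f_mul_eq_mul_logistic hk.ne' hδ.ne']]
  have hmem : ∀ u, u ∈ (fun u => (β + δ) / (δ * k) * u) ⁻¹' Icc 0 (1 / k) ↔
      0 ≤ u ∧ u ≤ 1 - β / (β + δ) := fun u => by
    have : 1 - β / (β + δ) = 1 / k / ((β + δ) / (δ * k)) := by field_simp; ring
    rw [this, le_div_iff₀' hc, mem_preimage, mem_Icc, mul_nonneg_iff_of_pos_left hc]
  have hβa : 0 < β / (β + δ) := div_pos hβ0 ha0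
  have hβa' : β / (β + δ) ≤ 1 / (β + δ) := by gcongr
  rw [hj, ← not_lt, ← one_div_lt_logistic_iff ha]
  constructor
  · intro h hm
    refine not_turbulent_logistic ha ha4 hm (h.mono fun u hu => ?_)
    rw [hmem] at hu
    exact ⟨hu.1, by linarith⟩
  · intro h
    refine (turbulent_logistic ha (not_lt.1 h)).mono fun u hu => ?_
    rw [hmem]
    have : 0 < 1 / (β + δ) := by positivity
    exact ⟨by linarith [hu.1], by linarith [hu.2]⟩
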